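/- arXiv:1608.05247 — 7 statements merged into one kernel-verified Lean document; each statement's English description precedes it below -/
import Mathlib

section
/- Let S₁ : M₃(ℝ) → M₃(ℝ) be any map satisfying the strict rank-one monotonicity condition: for every F with det F > 0 and all ξ, η ∈ ℝ³ with ξ⊗η ≠ 0 and det(F + ξ⊗η) > 0, one has ⟨S₁(F + ξ⊗η) − S₁(F), ξ⊗η⟩ > 0. Define the Cauchy stress σ(F) = S₁(F)·(Cof F)⁻¹ for F with det F > 0. Then σ is rank-one injective: for every F with det F > 0 and all ξ, η ∈ ℝ³ with det(F + ξ⊗η) > 0, σ(F + ξ⊗η) = σ(F) implies ξ⊗η = 0. -/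
open Matrix

/-- The space of real 3×3 matrices. -/
abbrev M3 : Type := Matrix (Fin 3) (Fin 3) ℝ

/-- The cofactor matrix: the transpose of the adjugate. For invertible `A` this
equals `det A • A⁻ᵀ`. -/
def Cof (A : M3) : M3 := A.adjugateᵀ

/-- The Frobenius inner product `⟨A, B⟩ = tr(Aᵀ B)` on 3×3 matrices. -/
def frob (A B : M3) : ℝ := (Aᵀ * B).trace

/-- A rank-one perturbation `ξ ⊗ η` does not change the product of `η` with the adjugate. -/
theorem vecMul_adjugate_add_vecMulVec {n R : Type*} [Fintype n] [DecidableEq n] [CommRing R]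
    (A : Matrix n n R) (ξ η : n → R) :
    η ᵥ* (A + vecMulVec ξ η).adjugate = η ᵥ* A.adjugate := by
  have key (B : Matrix n n R) (i : n) : (η ᵥ* B.adjugate) i = (B.updateRow i η).det := by
    rw [← cramer_transpose_apply, cramer_eq_adjugate_mulVec, ← adjugate_transpose,
      mulVec_transpose]
  ext i
  rw [key, key]
  refine det_eq_of_forall_row_eq_smul_add_const (Function.update ξ i 0) i (by simp) fun j k => ?_
  by_cases h : j = i
  · subst h; simp
  · simp [h, vecMulVec_apply]

theorem frob_vecMulVec (A : M3) (ξ η : Fin 3 → ℝ) :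
    frob A (vecMulVec ξ η) = ξ ⬝ᵥ (A *ᵥ η) := by
  rw [frob, mul_vecMulVec, trace_vecMulVec, mulVec_transpose, dotProduct_mulVec]

theorem Cof_mulVec_add_vecMulVec (F : M3) (ξ η : Fin 3 → ℝ) :
    Cof (F + vecMulVec ξ η) *ᵥ η = Cof F *ᵥ η := by
  simp only [Cof, mulVec_transpose, vecMul_adjugate_add_vecMulVec]

theorem isUnit_det_Cof {F : M3} (hF : 0 < F.det) : IsUnit (Cof F).det := by
  rw [Cof, det_transpose, det_adjugate]
  exact (pow_pos hF _).ne'.isUnit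

/-- If the first Piola–Kirchhoff stress `S₁` is strictly monotone along
rank-one lines (within matrices of positive determinant), then the Cauchy stress
`σ(F) = S₁(F)·(Cof F)⁻¹` is rank-one injective. -/
theorem cauchy_stress_rank_one_injective
    (S₁ σ : M3 → M3)
    (hmono : ∀ F : M3, 0 < F.det →
      ∀ ξ η : Fin 3 → ℝ, vecMulVec ξ η ≠ 0 → 0 < (F + vecMulVec ξ η).det →
        0 < frob (S₁ (F + vecMulVec ξ η) - S₁ F) (vecMulVec ξ η))
    (hσ : ∀ F : M3, 0 < F.det → σ F = S₁ F * (Cof F)⁻¹) :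
    ∀ F : M3, 0 < F.det →
      ∀ ξ η : Fin 3 → ℝ, 0 < (F + vecMulVec ξ η).det →
        σ (F + vecMulVec ξ η) = σ F → vecMulVec ξ η = 0 := by
  intro F hF ξ η hG hEq
  by_contra hne
  have hS (G : M3) (hG : 0 < G.det) : S₁ G = σ G * Cof G := by
    rw [hσ G hG, nonsing_inv_mul_cancel_right _ _ (isUnit_det_Cof hG)]
  have hpos := hmono F hF ξ η hne hG
  rw [frob_vecMulVec, hS _ hG, hS _ hF, hEq, sub_mulVec, ← mulVec_mulVec, ← mulVec_mulVec,
    Cof_mulVec_add_vecMulVec, sub_self, dotProduct_zero] at hpos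
  exact hpos.false
end

section
/- For every F ∈ M₃(ℝ) and all ξ, η ∈ ℝ³, the cofactor matrix satisfies Cof(F + ξ⊗η)·η = (Cof F)·η. -/
open Matrix

/-- For every 3×3 matrix `F` and all `ξ, η ∈ ℝ³`,
`Cof(F + ξ⊗η)·η = (Cof F)·η`. -/
theorem cof_rank_one_update_mulVec (F : M3) (ξ η : Fin 3 → ℝ) :
    (Cof (F + vecMulVec ξ η)).mulVec η = (Cof F).mulVec η := by
  ext i
  fin_cases i <;>
    simp [Cof, adjugate_fin_three, mulVec, dotProduct, Fin.sum_univ_three, vecMulVec_apply] <;>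
    ring
end

section
/- For every invertible F ∈ M₃(ℝ) and every H ∈ M₃(ℝ), the Fréchet derivative of the cofactor map at F in direction H is given by D Cof(F).H = (⟨F⁻ᵀ, H⟩·𝟙 − F⁻ᵀ·Hᵀ)·Cof F. -/
open Matrix

attribute [local instance] Matrix.normedAddCommGroup Matrix.normedSpace

/-- The adjugate of a perturbation of the identity of size three. -/
lemma adjugate_one_add_fin_three (K : M3) :
    (1 + K).adjugate = 1 + (K.trace • (1 : M3) - K) + K.adjugate := by
  ext i j
  fin_cases i <;> fin_cases j <;>
    simp [adjugate_fin_three, trace_fin_three] <;> ring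

/-- The exact second-order expansion of the cofactor map at an invertible matrix. -/
lemma Cof_add (F H : M3) (hF : IsUnit F.det) :
    Cof (F + H) = Cof F + (frob F⁻¹ᵀ H • (1 : M3) - F⁻¹ᵀ * Hᵀ) * Cof F + Cof H := by
  have hH : H * F⁻¹ * F = H := nonsing_inv_mul_cancel_right F H hF
  have hadj : F.adjugate * (H * F⁻¹).adjugate = H.adjugate := by
    rw [← adjugate_mul_distrib, hH]
  have hsum : F + H = (1 + H * F⁻¹) * F := by rw [add_mul, one_mul, hH]
  have htr : frob F⁻¹ᵀ H = (H * F⁻¹).trace := by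
    rw [frob, transpose_transpose, trace_mul_comm]
  rw [Cof, hsum, adjugate_mul_distrib, adjugate_one_add_fin_three, mul_add, mul_add, hadj,
    mul_one, htr]
  simp only [Cof, transpose_add, transpose_mul, transpose_sub, transpose_smul, transpose_one]

lemma Cof_smul (t : ℝ) (H : M3) : Cof (t • H) = t ^ 2 • Cof H := by
  simp [Cof, adjugate_smul, transpose_smul]

lemma differentiable_Cof : Differentiable ℝ Cof := by
  have hentry : ∀ i j, Differentiable ℝ fun A : M3 => A i j := fun i j =>
    differentiable_pi.1 (differentiable_pi.1 differentiable_id i) j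
  refine differentiable_pi.2 fun i => differentiable_pi.2 fun j => ?_
  fin_cases i <;> fin_cases j <;> simp [Cof, adjugate_fin_three] <;> fun_prop

/-- For invertible `F`, the Fréchet derivative of the cofactor map at `F`
is the linear map `H ↦ (⟨F⁻ᵀ, H⟩·𝟙 − F⁻ᵀ·Hᵀ)·Cof F`. -/
theorem hasFDerivAt_cof (F : M3) (hF : IsUnit F.det) :
    ∃ L : M3 →L[ℝ] M3, HasFDerivAt Cof L F ∧
      ∀ H : M3, L H = (frob F⁻¹ᵀ H • (1 : M3) - F⁻¹ᵀ * Hᵀ) * Cof F := by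
  refine ⟨fderiv ℝ Cof F, (differentiable_Cof F).hasFDerivAt, fun H => ?_⟩
  set R : M3 := (frob F⁻¹ᵀ H • (1 : M3) - F⁻¹ᵀ * Hᵀ) * Cof F with hR
  have hline : (fun t : ℝ => Cof (F + t • H)) = fun t => Cof F + t • R + t ^ 2 • Cof H := by
    funext t
    rw [Cof_add F (t • H) hF, Cof_smul, hR]
    simp only [frob, Matrix.mul_smul, trace_smul, transpose_smul, smul_assoc, ← smul_sub,
      Matrix.smul_mul]
  have hderiv : HasDerivAt (fun t : ℝ => Cof (F + t • H)) R 0 := by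
    rw [hline]
    refine ((((hasDerivAt_id (0 : ℝ)).smul_const R).const_add (Cof F)).fun_add
      ((hasDerivAt_pow 2 (0 : ℝ)).smul_const (Cof H))).congr_deriv ?_
    simp
  exact ((differentiable_Cof F).hasFDerivAt.hasLineDerivAt H).unique hderiv
end

section
/- Let F ∈ M₃(ℝ) with det F > 0, let ξ, η ∈ ℝ³, and set F̂ = F + ξ⊗η. If det F̂ > 0 and F̂·F̂ᵀ = F·Fᵀ, then ξ⊗η = 0. -/
open Matrix

/-- A rank-one perturbation of the identity that is a rotation is the identity. -/
theorem vecMulVec_eq_zero_of_one_add_mem_specialOrthogonal {n : Type*} [Fintype n] [DecidableEq n]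
    (a η : n → ℝ) (hdet : (1 + vecMulVec a η).det = 1)
    (horth : (1 + vecMulVec a η) * (1 + vecMulVec a η)ᵀ = 1) :
    vecMulVec a η = 0 := by
  have hηa : η ⬝ᵥ a = 0 := by
    rw [vecMulVec_eq Unit, det_one_add_replicateCol_mul_replicateRow] at hdet
    linarith
  have haη : a ⬝ᵥ η = 0 := by rw [dotProduct_comm, hηa]
  have hT : (1 + vecMulVec a η)ᵀ *ᵥ η = η := by
    rw [transpose_add, transpose_one, transpose_vecMulVec, add_mulVec, one_mulVec,
      vecMulVec_mulVec, haη]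
    simp
  have hη : (1 + vecMulVec a η) *ᵥ η = η := by
    have h := congrArg (· *ᵥ η) horth
    simpa only [← mulVec_mulVec, hT, one_mulVec] using h
  rw [add_mulVec, one_mulVec, add_eq_left, vecMulVec_mulVec] at hη
  ext i j
  have hi := congrFun hη i
  simp only [Pi.smul_apply, MulOpposite.smul_eq_mul_unop, MulOpposite.unop_op, Pi.zero_apply,
    mul_eq_zero, dotProduct_self_eq_zero] at hi
  rcases hi with h | h <;> simp [vecMulVec_apply, h]

/-- If `det F > 0`, `F̂ = F + ξ⊗η` has `det F̂ > 0` and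
`F̂·F̂ᵀ = F·Fᵀ`, then `ξ⊗η = 0`. -/
theorem rank_one_twin_with_equal_left_cauchy_green
    (F : M3) (hF : 0 < F.det) (ξ η : Fin 3 → ℝ)
    (hdet : 0 < (F + vecMulVec ξ η).det)
    (hB : (F + vecMulVec ξ η) * (F + vecMulVec ξ η)ᵀ = F * Fᵀ) :
    vecMulVec ξ η = 0 := by
  have hu : IsUnit F.det := hF.ne'.isUnit
  have hξ : vecMulVec ξ η = F * vecMulVec (F⁻¹ *ᵥ ξ) η := by
    rw [mul_vecMulVec, mulVec_mulVec, mul_nonsing_inv F hu, one_mulVec]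
  have hfac : F + vecMulVec ξ η = F * (1 + vecMulVec (F⁻¹ *ᵥ ξ) η) := by
    rw [hξ, mul_add, mul_one]
  have hdet_eq : (F + vecMulVec ξ η).det = F.det := by
    have h := congrArg det hB
    rw [det_mul, det_mul, det_transpose, det_transpose] at h
    exact (mul_self_inj hdet.le hF.le).mp h
  rw [hξ, vecMulVec_eq_zero_of_one_add_mem_specialOrthogonal _ _ ?_ ?_, mul_zero]
  · rw [hfac, det_mul] at hdet_eq
    exact (mul_eq_left₀ hF.ne').mp hdet_eq
  · have hFT : IsUnit Fᵀ := (isUnit_iff_isUnit_det _).mpr (by rwa [det_transpose])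
    have hFu : IsUnit F := (isUnit_iff_isUnit_det _).mpr hu
    rw [hfac, transpose_mul, mul_assoc, ← mul_assoc _ _ Fᵀ] at hB
    exact hFT.mul_right_cancel (by rw [hFu.mul_left_cancel hB, one_mul])
end

section
/- Let σ̃ be an injective map from the symmetric positive-definite 3×3 real matrices to the symmetric 3×3 real matrices, and define σ(F) = σ̃(F·Fᵀ) for F with det F > 0. Then for every F with det F > 0 and all ξ, η ∈ ℝ³ with det(F + ξ⊗η) > 0, σ(F + ξ⊗η) = σ(F) implies ξ⊗η = 0. -/
open Matrix

namespace Matrix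

variable {n : Type*} [Fintype n] [DecidableEq n]

theorem posDef_mul_transpose_self_of_isUnit_det {F : Matrix n n ℝ} (hF : IsUnit F.det) :
    (F * Fᵀ).PosDef := by
  rw [← conjTranspose_eq_transpose_of_trivial]
  exact PosDef.mul_conjTranspose_self F
    (vecMul_injective_iff_isUnit.2 ((isUnit_iff_isUnit_det F).2 hF))

theorem vecMulVec_eq_zero_of_one_add_mul_transpose_eq_one {w η : n → ℝ}
    (hdet : 0 < (1 + vecMulVec w η).det)
    (h : (1 + vecMulVec w η) * (1 + vecMulVec w η)ᵀ = 1) : vecMulVec w η = 0 := by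
  have hdot : η ⬝ᵥ w = 0 := by
    have hsq := congrArg det h
    rw [det_mul, det_transpose, det_one] at hsq
    have hd : (1 + vecMulVec w η).det = 1 + η ⬝ᵥ w := by
      rw [vecMulVec_eq Unit, det_one_add_replicateCol_mul_replicateRow]
    rw [hd] at hsq hdet
    nlinarith
  have htr := congrArg trace h
  rw [transpose_add, transpose_one, transpose_vecMulVec, add_mul, one_mul, mul_add,
    mul_one, vecMulVec_mul_vecMulVec] at htr
  simp only [trace_add, trace_vecMulVec, dotProduct_smul, dotProduct_comm w η, hdot,
    smul_eq_mul] at htr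
  have hprod : (η ⬝ᵥ η) * (w ⬝ᵥ w) = 0 := by linarith
  rw [mul_eq_zero, dotProduct_self_eq_zero, dotProduct_self_eq_zero] at hprod
  rcases hprod with rfl | rfl
  · ext; simp [vecMulVec_apply]
  · ext; simp [vecMulVec_apply]

/-- Two matrices of positive determinant that differ by a dyad and share the same left
Cauchy–Green tensor coincide. -/
theorem vecMulVec_eq_zero_of_add_mul_transpose_eq {F : Matrix n n ℝ} {ξ η : n → ℝ}
    (hF : 0 < F.det) (hG : 0 < (F + vecMulVec ξ η).det)
    (h : (F + vecMulVec ξ η) * (F + vecMulVec ξ η)ᵀ = F * Fᵀ) : vecMulVec ξ η = 0 := by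
  have hu : IsUnit F.det := hF.ne'.isUnit
  have hdyad : vecMulVec ξ η = F * vecMulVec (F⁻¹ *ᵥ ξ) η := by
    rw [mul_vecMulVec, mulVec_mulVec, mul_nonsing_inv F hu, one_mulVec]
  have hG' : F + vecMulVec ξ η = F * (1 + vecMulVec (F⁻¹ *ᵥ ξ) η) := by
    rw [mul_add, mul_one, ← hdyad]
  rw [hG'] at hG h
  rw [det_mul] at hG
  rw [hdyad, vecMulVec_eq_zero_of_one_add_mul_transpose_eq_one (pos_of_mul_pos_right hG hF.le),
    mul_zero]
  have hFu : IsUnit F := (isUnit_iff_isUnit_det F).2 hu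
  have hFtu : IsUnit Fᵀ := (isUnit_iff_isUnit_det Fᵀ).2 (by rwa [det_transpose])
  apply hFu.mul_left_cancel
  apply hFtu.mul_right_cancel
  simpa only [transpose_mul, mul_assoc, mul_one] using h

end Matrix

/-- If `σ̃` maps symmetric positive-definite matrices injectively into
symmetric matrices and `σ(F) = σ̃(F·Fᵀ)`, then `σ` is rank-one injective on matrices of
positive determinant. -/
theorem invertible_isotropic_cauchy_stress_rank_one_injective
    (σt : M3 → M3)
    (hsym : ∀ B : M3, B.PosDef → (σt B).IsSymm)
    (hinj : ∀ B₁ B₂ : M3, B₁.PosDef → B₂.PosDef → σt B₁ = σt B₂ → B₁ = B₂)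
    (σ : M3 → M3) (hσ : ∀ F : M3, 0 < F.det → σ F = σt (F * Fᵀ)) :
    ∀ F : M3, 0 < F.det → ∀ ξ η : Fin 3 → ℝ, 0 < (F + vecMulVec ξ η).det →
      σ (F + vecMulVec ξ η) = σ F → vecMulVec ξ η = 0 := by
  intro F hF ξ η hG h
  rw [hσ _ hG, hσ _ hF] at h
  exact vecMulVec_eq_zero_of_add_mul_transpose_eq hF hG
    (hinj _ _ (posDef_mul_transpose_self_of_isUnit_det hG.ne'.isUnit)
      (posDef_mul_transpose_self_of_isUnit_det hF.ne'.isUnit) h)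
end

section
/- Let μ > 0 and let W : GL⁺(3) → ℝ be the Blatz-Ko stored energy density W(F) = (μ/2)·(‖F‖² + 2/det F − 5). Then W is strictly rank-one convex: for every F ∈ GL⁺(3) and all ξ, η ∈ ℝ³ with ξ⊗η ≠ 0 such that F + t·ξ⊗η ∈ GL⁺(3) for all t ∈ [0,1], the function t ↦ W(F + t·ξ⊗η) is strictly convex on [0,1]. -/
open Matrix

/-- The determinant is affine along rank-one lines. -/
theorem det_add_smul_vecMulVec_fin_three (F : Matrix (Fin 3) (Fin 3) ℝ) (ξ η : Fin 3 → ℝ)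
    (t : ℝ) :
    (F + t • vecMulVec ξ η).det = F.det + t * ((F + vecMulVec ξ η).det - F.det) := by
  simp only [det_fin_three, Matrix.add_apply, Matrix.smul_apply, vecMulVec_apply, smul_eq_mul]
  ring

theorem trace_transpose_mul_self_add_smul {n : Type*} [Fintype n] (F A : Matrix n n ℝ) (t : ℝ) :
    ((F + t • A)ᵀ * (F + t • A)).trace =
      (Fᵀ * F).trace + t * (2 * (Fᵀ * A).trace) + t ^ 2 * (Aᵀ * A).trace := by
  have h : (Aᵀ * F).trace = (Fᵀ * A).trace := by
    rw [← trace_transpose, transpose_mul, transpose_transpose]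
  simp only [transpose_add, transpose_smul, add_mul, mul_add, smul_mul, Matrix.mul_smul, trace_add,
    trace_smul, smul_eq_mul, h]
  ring

theorem trace_transpose_mul_self_pos {n : Type*} [Fintype n] {A : Matrix n n ℝ} (hA : A ≠ 0) :
    0 < (Aᵀ * A).trace := by
  have h := (posSemidef_conjTranspose_mul_self A).trace_nonneg
  have h0 := mt trace_conjTranspose_mul_self_eq_zero_iff.mp hA
  rw [conjTranspose_eq_transpose_of_trivial] at h h0
  exact lt_of_le_of_ne h (Ne.symm h0)

/-- A quadratic with positive leading coefficient plus the reciprocal of a positive affine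
function is strictly convex. -/
theorem strictConvexOn_quadratic_add_two_div_affine {s : Set ℝ} (hs : Convex ℝ s)
    {p q r d e : ℝ} (hr : 0 < r) (hd : ∀ t ∈ s, 0 < d + t * e) :
    StrictConvexOn ℝ s fun t => p + t * q + t ^ 2 * r + 2 / (d + t * e) := by
  have hquad : StrictConvexOn ℝ s fun t => p + t * q + t ^ 2 * r := by
    refine ⟨hs, fun x _ y _ hxy a b ha hb hab => ?_⟩
    obtain rfl : b = 1 - a := by linarith
    have h : 0 < a * (1 - a) * r * (x - y) ^ 2 := by
      have := sq_pos_of_ne_zero (sub_ne_zero.mpr hxy)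
      positivity
    simp only [smul_eq_mul]
    linear_combination h
  refine hquad.add_convexOn ⟨hs, fun x hx y hy a b ha hb hab => ?_⟩
  have h := (convexOn_zpow (𝕜 := ℝ) (-1)).2 (hd x hx) (hd y hy) ha hb hab
  simp only [smul_eq_mul, _root_.zpow_neg_one] at h ⊢
  have haff : a * (d + x * e) + b * (d + y * e) = d + (a * x + b * y) * e := by
    linear_combination d * hab
  rw [haff] at h
  simp only [div_eq_mul_inv]
  linarith

/-- The uni-constant Blatz-Ko stored energy density
`W(F) = (μ/2)·(‖F‖² + 2/det F − 5)` (with `‖F‖² = tr(FᵀF)` the squared Frobenius norm)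
is strictly rank-one convex on `GL⁺(3)`: it is strictly convex along every rank-one
segment lying in `GL⁺(3)`. -/
theorem blatz_ko_strictly_rank_one_convex
    (μ : ℝ) (hμ : 0 < μ) (W : M3 → ℝ)
    (hW : ∀ F : M3, 0 < F.det → W F = μ / 2 * ((Fᵀ * F).trace + 2 / F.det - 5)) :
    ∀ F : M3, 0 < F.det → ∀ ξ η : Fin 3 → ℝ, vecMulVec ξ η ≠ 0 →
      (∀ t ∈ Set.Icc (0:ℝ) 1, 0 < (F + t • vecMulVec ξ η).det) →
      StrictConvexOn ℝ (Set.Icc (0:ℝ) 1) (fun t => W (F + t • vecMulVec ξ η)) := by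
  intro F _ ξ η hA hdet
  set A := vecMulVec ξ η
  have hD (t : ℝ) : (F + t • A).det = F.det + t * ((F + A).det - F.det) :=
    det_add_smul_vecMulVec_fin_three F ξ η t
  have hconv := strictConvexOn_quadratic_add_two_div_affine (convex_Icc (0 : ℝ) 1)
    (p := (Fᵀ * F).trace - 5) (q := 2 * (Fᵀ * A).trace) (trace_transpose_mul_self_pos hA)
    (fun t ht => hD t ▸ hdet t ht)
  refine ⟨convex_Icc 0 1, fun x hx y hy hxy a b ha hb hab => ?_⟩
  have h := hconv.2 hx hy hxy ha hb hab
  have hz := convex_Icc (0 : ℝ) 1 hx hy ha.le hb.le hab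
  simp only [hW _ (hdet x hx), hW _ (hdet y hy), hW _ (hdet _ hz),
    trace_transpose_mul_self_add_smul, hD]
  simp only [smul_eq_mul] at h ⊢
  linear_combination μ / 2 * h
end

section
/- Let μ > 0 and define σ̃(B) = (μ/det B)·(√(det B)·B − 𝟙) for symmetric positive-definite 3×3 real matrices B. Then σ̃ is not injective: there exist 0 < α₁ < α₂ with σ̃(α₁·𝟙) = σ̃(α₂·𝟙). Equivalently, the function f(α) = μ·(α^(−1/2) − α^(−3)) on (0,∞), which satisfies σ̃(α·𝟙) = f(α)·𝟙, is not injective. -/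
open Matrix

lemma sq_rpow_neg_half {u : ℝ} (hu : 0 < u) : (u ^ 2) ^ (-1/2 : ℝ) = u⁻¹ := by
  rw [← Real.rpow_natCast, ← Real.rpow_mul hu.le, ← Real.rpow_neg_one]
  norm_num

lemma sq_rpow_neg_three {u : ℝ} (hu : 0 < u) : (u ^ 2) ^ (-3 : ℝ) = (u ^ 6)⁻¹ := by
  rw [Real.rpow_neg (by positivity)]
  norm_cast
  ring

/-- The scalar stress response `μ·(α^(−1/2) − α^(−3))` takes the same value at two distinct
points `α` and `4α`. -/
lemma exists_blatz_ko_scalar_eq (μ : ℝ) :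
    ∃ α₁ α₂ : ℝ, 0 < α₁ ∧ α₁ < α₂ ∧
      μ * (α₁ ^ (-1/2 : ℝ) - α₁ ^ (-3 : ℝ)) = μ * (α₂ ^ (-1/2 : ℝ) - α₂ ^ (-3 : ℝ)) := by
  obtain ⟨u, hu, hu5⟩ : ∃ u : ℝ, 0 < u ∧ u ^ 5 = 63 / 32 := by
    refine ⟨(63 / 32 : ℝ) ^ (1 / 5 : ℝ), by positivity, ?_⟩
    rw [← Real.rpow_natCast, ← Real.rpow_mul (by norm_num)]
    norm_num
  refine ⟨u ^ 2, (2 * u) ^ 2, by positivity, by nlinarith [pow_pos hu 2], ?_⟩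
  rw [sq_rpow_neg_half hu, sq_rpow_neg_three hu, sq_rpow_neg_half (by positivity),
    sq_rpow_neg_three (by positivity)]
  have h6 : u ^ 6 = 63 / 32 * u := by rw [← hu5]; ring
  rw [mul_pow, h6]
  field_simp
  ring

/-- The Blatz-Ko response at a spherical tensor `α·𝟙`. -/
lemma blatz_ko_smul_one (μ : ℝ) {α : ℝ} (hα : 0 < α) :
    (μ / (α • (1 : M3)).det) • (Real.sqrt (α • (1 : M3)).det • (α • (1 : M3)) - 1) =
      (μ * (α ^ (-1/2 : ℝ) - α ^ (-3 : ℝ))) • (1 : M3) := by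
  obtain ⟨u, hu, rfl⟩ : ∃ u : ℝ, 0 < u ∧ u ^ 2 = α :=
    ⟨Real.sqrt α, Real.sqrt_pos.2 hα, Real.sq_sqrt hα.le⟩
  have hdet : ((u ^ 2) • (1 : M3)).det = (u ^ 3) ^ 2 := by
    rw [Matrix.det_smul, Matrix.det_one, Fintype.card_fin]
    ring
  have hsub (c : ℝ) : c • (1 : M3) - 1 = (c - 1) • (1 : M3) := by rw [sub_smul, one_smul]
  rw [hdet, Real.sqrt_sq (by positivity), sq_rpow_neg_half hu, sq_rpow_neg_three hu, smul_smul,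
    hsub, smul_smul]
  congr 1
  field_simp

/-- The Blatz-Ko Cauchy stress response
`σ̃(B) = (μ/det B)·(√(det B)·B − 𝟙)` on symmetric positive-definite matrices is not
injective: there are `0 < α₁ < α₂` with `σ̃(α₁·𝟙) = σ̃(α₂·𝟙)`. Equivalently, the
function `f(α) = μ·(α^(−1/2) − α^(−3))`, which satisfies `σ̃(α·𝟙) = f(α)·𝟙` for
`α > 0`, is not injective on `(0,∞)`. -/
theorem blatz_ko_cauchy_stress_not_injective
    (μ : ℝ) (hμ : 0 < μ) (σt : M3 → M3)
    (hσt : ∀ B : M3, B.PosDef → σt B = (μ / B.det) • (Real.sqrt B.det • B - 1)) :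
    (∃ α₁ α₂ : ℝ, 0 < α₁ ∧ α₁ < α₂ ∧ σt (α₁ • (1 : M3)) = σt (α₂ • (1 : M3))) ∧
    (∀ α : ℝ, 0 < α →
      σt (α • (1 : M3)) = (μ * (α ^ (-1/2 : ℝ) - α ^ (-3 : ℝ))) • (1 : M3)) ∧
    ¬ Set.InjOn (fun α : ℝ => μ * (α ^ (-1/2 : ℝ) - α ^ (-3 : ℝ))) (Set.Ioi 0) := by
  have hσ : ∀ α : ℝ, 0 < α →
      σt (α • (1 : M3)) = (μ * (α ^ (-1/2 : ℝ) - α ^ (-3 : ℝ))) • (1 : M3) := fun α hα => by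
    rw [hσt _ (Matrix.PosDef.one.smul hα), blatz_ko_smul_one μ hα]
  obtain ⟨α₁, α₂, h₁, h₁₂, heq⟩ := exists_blatz_ko_scalar_eq μ
  have h₂ : 0 < α₂ := h₁.trans h₁₂
  exact ⟨⟨α₁, α₂, h₁, h₁₂, by rw [hσ α₁ h₁, hσ α₂ h₂, heq]⟩, hσ,
    fun hinj => h₁₂.ne (hinj h₁ h₂ heq)⟩
end
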